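/- Let (Ω, μ) be a measure space and 1 < p < ∞. Then there exists m > 0, depending only on p, such that for all F, G ∈ L^p(μ): max(‖F+G‖_p, ‖F−G‖_p)^{max(p,2)} ≥ ‖F‖_p^{max(p,2)} + m ‖G‖_p^{max(p,2)}. -/

import Mathlib

open MeasureTheory

/-- Clarkson's two-point inequality for exponents at least two. -/
lemma abs_rpow_add_abs_rpow_le {p : ℝ} (hp : 2 ≤ p) (a b : ℝ) :
    |a| ^ p + |b| ^ p ≤ (|a + b| ^ p + |a - b| ^ p) / 2 := by
  have hsq (x : ℝ) : |x| ^ p = (x ^ 2) ^ (p / 2) := by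
    rw [← sq_abs, ← Real.rpow_natCast, ← Real.rpow_mul (abs_nonneg x)]
    congr 1
    push_cast
    ring
  have hq : 1 ≤ p / 2 := by linarith
  simp only [hsq]
  have hadd := Real.add_rpow_le_rpow_add (sq_nonneg a) (sq_nonneg b) hq
  have hmean := (convexOn_rpow hq).2 (Set.mem_Ici.2 (sq_nonneg (a + b)))
    (Set.mem_Ici.2 (sq_nonneg (a - b)))
    (by norm_num : (0 : ℝ) ≤ 1 / 2) (by norm_num : (0 : ℝ) ≤ 1 / 2) (by norm_num)
  simp only [smul_eq_mul] at hmean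
  rw [show 1 / 2 * (a + b) ^ 2 + 1 / 2 * (a - b) ^ 2 = a ^ 2 + b ^ 2 by ring] at hmean
  linarith

/-- For `1 < p < 2`, the function `|x| ^ p` is strongly convex on bounded intervals. -/
lemma convexOn_abs_rpow_sub_sq {p R : ℝ} (hp : 1 < p) (hp2 : p < 2) (hR : 0 < R) :
    ConvexOn ℝ (Set.Icc (-R) R)
      (fun x : ℝ => |x| ^ p - p * (p - 1) / 2 * R ^ (p - 2) * x ^ 2) := by
  set k := p * (p - 1) / 2 * R ^ (p - 2) with hk
  have himage : (fun x : ℝ => ‖x‖) '' Set.Icc (-R) R = Set.Icc 0 R := by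
    ext y
    constructor
    · rintro ⟨x, hx, rfl⟩
      exact ⟨norm_nonneg x, abs_le.2 hx⟩
    · rintro ⟨hy, hyR⟩
      exact ⟨y, ⟨by linarith, hyR⟩, abs_of_nonneg hy⟩
  have hpow {x : ℝ} (hx : x ∈ Set.Ioo 0 R) : R ^ (p - 2) ≤ x ^ (p - 2) :=
    Real.rpow_le_rpow_of_nonpos hx.1 hx.2.le (by linarith)
  have hderiv (x : ℝ) (hx : x ∈ Set.Ioo 0 R) :
      HasDerivAt (fun x : ℝ => x ^ p - k * x ^ 2) (p * x ^ (p - 1) - k * (2 * x)) x := by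
    have h := (Real.hasDerivAt_rpow_const (p := p) (Or.inl hx.1.ne')).sub
      ((hasDerivAt_pow 2 x).const_mul k)
    rw [Nat.cast_ofNat, Nat.add_one_sub_one, pow_one] at h
    exact h
  have hderiv2 (x : ℝ) (hx : x ∈ Set.Ioo 0 R) :
      HasDerivAt (fun x : ℝ => p * x ^ (p - 1) - k * (2 * x))
        (p * ((p - 1) * x ^ (p - 2)) - k * 2) x := by
    have h := ((Real.hasDerivAt_rpow_const (p := p - 1) (Or.inl hx.1.ne')).const_mul p).sub
      (((hasDerivAt_id x).const_mul 2).const_mul k)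
    rw [show p - 1 - 1 = p - 2 by ring, mul_one] at h
    exact h
  have hcont : ContinuousOn (fun x : ℝ => x ^ p - k * x ^ 2) (Set.Icc 0 R) :=
    ((Real.continuous_rpow_const (by linarith)).sub
      (continuous_const.mul (continuous_pow 2))).continuousOn
  have hconv : ConvexOn ℝ (Set.Icc 0 R) (fun x : ℝ => x ^ p - k * x ^ 2) := by
    refine convexOn_of_hasDerivWithinAt2_nonneg (convex_Icc 0 R) hcont
      (f' := fun x => p * x ^ (p - 1) - k * (2 * x))
      (f'' := fun x => p * ((p - 1) * x ^ (p - 2)) - k * 2) ?_ ?_ ?_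
    all_goals rw [interior_Icc]; intro x hx
    · exact (hderiv x hx).hasDerivWithinAt
    · exact (hderiv2 x hx).hasDerivWithinAt
    · have h := mul_le_mul_of_nonneg_left (hpow hx)
        (show 0 ≤ p * (p - 1) from mul_nonneg (by linarith) (by linarith))
      rw [hk]
      linarith
  have hmono : MonotoneOn (fun x : ℝ => x ^ p - k * x ^ 2) (Set.Icc 0 R) := by
    refine monotoneOn_of_deriv_nonneg (convex_Icc 0 R) hcont ?_ ?_
    all_goals rw [interior_Icc]; intro x hx
    · exact (hderiv x hx).differentiableAt.differentiableWithinAt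
    · rw [(hderiv x hx).deriv]
      have hx1 : x ^ (p - 1) = x ^ (p - 2) * x := by
        rw [← Real.rpow_add_one hx.1.ne']
        ring_nf
      have hle : (p - 1) * R ^ (p - 2) ≤ x ^ (p - 2) :=
        (mul_le_of_le_one_left (Real.rpow_nonneg hR.le _) (by linarith)).trans (hpow hx)
      have h := mul_le_mul_of_nonneg_left hle (mul_nonneg (by linarith) hx.1.le : 0 ≤ p * x)
      rw [hx1, hk]
      linarith
  refine (ConvexOn.comp (himage ▸ hconv) (convexOn_norm (convex_Icc (-R) R))
    (himage ▸ hmono)).congr ?_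
  intro x _
  simp [Function.comp, Real.norm_eq_abs, sq_abs]

/-- The two-point inequality behind the 2-uniform convexity of `L^p` for `1 < p < 2`. -/
lemma mul_sq_le_rpow_mul_sub {p : ℝ} (hp : 1 < p) (hp2 : p < 2) (a b : ℝ) :
    p * (p - 1) / 2 * b ^ 2 ≤ (|a + b| ^ p + |a - b| ^ p) ^ ((2 - p) / p) *
      ((|a + b| ^ p + |a - b| ^ p) / 2 - |a| ^ p) := by
  have hp0 : 0 < p := by linarith
  set R := max |a + b| |a - b| with hRdef
  have hR0 : 0 ≤ R := le_max_of_le_left (abs_nonneg _)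
  rcases hR0.eq_or_lt with hR | hR
  · have h1 : a + b = 0 := abs_eq_zero.1 (le_antisymm (hR ▸ le_max_left _ _) (abs_nonneg _))
    have h2 : a - b = 0 := abs_eq_zero.1 (le_antisymm (hR ▸ le_max_right _ _) (abs_nonneg _))
    have ha : a = 0 := by linarith
    have hb : b = 0 := by linarith
    simp [ha, hb, Real.zero_rpow hp0.ne']
  have h := (convexOn_abs_rpow_sub_sq hp hp2 hR).2 (abs_le.1 (le_max_left |a + b| |a - b|))
    (abs_le.1 (le_max_right |a + b| |a - b|))
    (by norm_num : (0 : ℝ) ≤ 1 / 2) (by norm_num : (0 : ℝ) ≤ 1 / 2) (by norm_num)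
  simp only [smul_eq_mul] at h
  rw [show 1 / 2 * (a + b) + 1 / 2 * (a - b) = a by ring] at h
  set S := |a + b| ^ p + |a - b| ^ p with hS
  have hconv : p * (p - 1) / 2 * R ^ (p - 2) * b ^ 2 ≤ S / 2 - |a| ^ p := by
    rw [hS]
    linarith
  have hRp : R ^ p ≤ S := by
    rcases max_choice |a + b| |a - b| with h | h <;> rw [hRdef, h, hS]
    · exact le_add_of_nonneg_right (by positivity)
    · exact le_add_of_nonneg_left (by positivity)
  have hRS : R ^ (2 - p) ≤ S ^ ((2 - p) / p) := by
    have h := Real.rpow_le_rpow (by positivity) hRp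
      (div_nonneg (by linarith) hp0.le : 0 ≤ (2 - p) / p)
    rwa [← Real.rpow_mul hR.le, mul_div_cancel₀ _ hp0.ne'] at h
  have hk : 0 ≤ p * (p - 1) / 2 :=
    div_nonneg (mul_nonneg hp0.le (by linarith)) zero_le_two
  have hD : 0 ≤ S / 2 - |a| ^ p := le_trans (by positivity) hconv
  calc p * (p - 1) / 2 * b ^ 2
      = R ^ (2 - p) * (p * (p - 1) / 2 * R ^ (p - 2) * b ^ 2) := by
        have h1 : R ^ (2 - p) * R ^ (p - 2) = 1 := by
          rw [← Real.rpow_add hR]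
          simp
        linear_combination -(p * (p - 1) / 2 * b ^ 2) * h1
    _ ≤ R ^ (2 - p) * (S / 2 - |a| ^ p) := by gcongr
    _ ≤ S ^ ((2 - p) / p) * (S / 2 - |a| ^ p) := by gcongr

/-- Hölder's inequality for a function dominated by a product of powers. -/
lemma integral_le_rpow_integral_mul_rpow_integral {Ω : Type*} [MeasurableSpace Ω] {μ : Measure Ω}
    {f g h : Ω → ℝ} (hf : Integrable f μ) (hg : Integrable g μ) (hh : Integrable h μ)
    (hf0 : 0 ≤ᵐ[μ] f) (hg0 : 0 ≤ᵐ[μ] g) (hh0 : 0 ≤ᵐ[μ] h) {α β : ℝ} (hα : 0 ≤ α) (hβ : 0 ≤ β)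
    (hαβ : α + β = 1) (hle : ∀ᵐ x ∂μ, h x ≤ f x ^ α * g x ^ β) :
    ∫ x, h x ∂μ ≤ (∫ x, f x ∂μ) ^ α * (∫ x, g x ∂μ) ^ β := by
  have hF : 0 ≤ ∫ x, f x ∂μ := integral_nonneg_of_ae hf0
  have hG : 0 ≤ ∫ x, g x ∂μ := integral_nonneg_of_ae hg0
  rw [← ENNReal.ofReal_le_ofReal_iff (by positivity),
    ofReal_integral_eq_lintegral_ofReal hh hh0, ENNReal.ofReal_mul (by positivity),
    ← ENNReal.ofReal_rpow_of_nonneg hF hα, ← ENNReal.ofReal_rpow_of_nonneg hG hβ,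
    ofReal_integral_eq_lintegral_ofReal hf hf0, ofReal_integral_eq_lintegral_ofReal hg hg0]
  refine le_trans (lintegral_mono_ae ?_) (ENNReal.lintegral_mul_norm_pow_le
    hf.aestronglyMeasurable.aemeasurable.ennreal_ofReal
    hg.aestronglyMeasurable.aemeasurable.ennreal_ofReal hα hβ hαβ)
  filter_upwards [hf0, hg0, hle] with x hfx hgx hx
  rw [ENNReal.ofReal_rpow_of_nonneg hfx hα, ENNReal.ofReal_rpow_of_nonneg hgx hβ,
    ← ENNReal.ofReal_mul (Real.rpow_nonneg hfx α)]
  exact ENNReal.ofReal_le_ofReal hx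

section Lp

variable {Ω : Type*} [MeasurableSpace Ω] {μ : Measure Ω} {p : ℝ}

lemma norm_Lp_nonneg {q : ENNReal} (F : Lp ℝ q μ) : 0 ≤ ‖F‖ := by
  rw [Lp.norm_def]
  exact ENNReal.toReal_nonneg

lemma integrable_abs_rpow_coeFn_Lp (hp : 0 < p) (F : Lp ℝ (ENNReal.ofReal p) μ) :
    Integrable (fun x => |F x| ^ p) μ := by
  have h := (Lp.memLp F).integrable_norm_rpow (by simpa using hp) ENNReal.ofReal_ne_top
  simpa only [ENNReal.toReal_ofReal hp.le, Real.norm_eq_abs] using h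

lemma norm_Lp_rpow_eq_integral (hp : 0 < p) (F : Lp ℝ (ENNReal.ofReal p) μ) :
    ‖F‖ ^ p = ∫ x, |F x| ^ p ∂μ := by
  have hint : 0 ≤ ∫ x, |F x| ^ p ∂μ := integral_nonneg fun x => by positivity
  rw [Lp.norm_def, (Lp.memLp F).eLpNorm_eq_integral_rpow_norm (by simpa using hp)
    ENNReal.ofReal_ne_top]
  simp only [ENNReal.toReal_ofReal hp.le, Real.norm_eq_abs]
  rw [ENNReal.toReal_ofReal (by positivity), Real.rpow_inv_rpow hint hp.ne']

/-- The pointwise sum `|F + G| ^ p + |F - G| ^ p` integrates to the sum of the norms' powers. -/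
lemma integrable_and_integral_abs_add_rpow_add_abs_sub_rpow (hp : 0 < p)
    (F G : Lp ℝ (ENNReal.ofReal p) μ) :
    Integrable (fun x => |F x + G x| ^ p + |F x - G x| ^ p) μ ∧
      ∫ x, (|F x + G x| ^ p + |F x - G x| ^ p) ∂μ = ‖F + G‖ ^ p + ‖F - G‖ ^ p := by
  have hae : (fun x => |(F + G) x| ^ p + |(F - G) x| ^ p) =ᵐ[μ]
      fun x => |F x + G x| ^ p + |F x - G x| ^ p := by
    filter_upwards [Lp.coeFn_add F G, Lp.coeFn_sub F G] with x h1 h2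
    rw [h1, h2, Pi.add_apply, Pi.sub_apply]
  have h1 := integrable_abs_rpow_coeFn_Lp hp (F + G)
  have h2 := integrable_abs_rpow_coeFn_Lp hp (F - G)
  refine ⟨(h1.add h2).congr hae, ?_⟩
  rw [← integral_congr_ae hae, integral_add h1 h2, norm_Lp_rpow_eq_integral hp,
    norm_Lp_rpow_eq_integral hp]

lemma norm_add_rpow_add_norm_sub_rpow_le (hp : 0 < p) (F G : Lp ℝ (ENNReal.ofReal p) μ) :
    ‖F + G‖ ^ p + ‖F - G‖ ^ p ≤ 2 * max ‖F + G‖ ‖F - G‖ ^ p := by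
  have h1 := Real.rpow_le_rpow (norm_Lp_nonneg _) (le_max_left ‖F + G‖ ‖F - G‖) hp.le
  have h2 := Real.rpow_le_rpow (norm_Lp_nonneg _) (le_max_right ‖F + G‖ ‖F - G‖) hp.le
  linarith

lemma norm_rpow_add_norm_rpow_le (hp : 2 ≤ p) (F G : Lp ℝ (ENNReal.ofReal p) μ) :
    ‖F‖ ^ p + ‖G‖ ^ p ≤ max ‖F + G‖ ‖F - G‖ ^ p := by
  have hp0 : 0 < p := by linarith
  obtain ⟨hint, heq⟩ := integrable_and_integral_abs_add_rpow_add_abs_sub_rpow hp0 F G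
  have hF := integrable_abs_rpow_coeFn_Lp hp0 F
  have hG := integrable_abs_rpow_coeFn_Lp hp0 G
  have h := integral_mono (hF.add hG) (hint.div_const 2)
    fun x => abs_rpow_add_abs_rpow_le hp (F x) (G x)
  simp only [Pi.add_apply] at h
  rw [integral_add hF hG, integral_div, heq, ← norm_Lp_rpow_eq_integral hp0,
    ← norm_Lp_rpow_eq_integral hp0] at h
  linarith [norm_add_rpow_add_norm_sub_rpow_le hp0 F G]

/-- 2-uniform convexity of `L^p` for `1 < p < 2`. -/
lemma norm_sq_add_mul_norm_sq_le (hp : 1 < p) (hp2 : p < 2) (F G : Lp ℝ (ENNReal.ofReal p) μ) :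
    ‖F‖ ^ (2 : ℝ) + p * (p - 1) / 2 / 2 ^ ((2 - p) / p) * ‖G‖ ^ (2 : ℝ) ≤
      max ‖F + G‖ ‖F - G‖ ^ (2 : ℝ) := by
  have hp0 : 0 < p := by linarith
  obtain ⟨hS, hSeq⟩ := integrable_and_integral_abs_add_rpow_add_abs_sub_rpow hp0 F G
  have hF := integrable_abs_rpow_coeFn_Lp hp0 F
  have hG := integrable_abs_rpow_coeFn_Lp hp0 G
  set S : Ω → ℝ := fun x => |F x + G x| ^ p + |F x - G x| ^ p with hSdef
  set k := p * (p - 1) / 2 with hkdef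
  have hk : 0 < k := div_pos (mul_pos hp0 (by linarith)) two_pos
  set M := max ‖F + G‖ ‖F - G‖ with hMdef
  have hM : 0 ≤ M := le_max_of_le_left (norm_Lp_nonneg _)
  have hF0 := norm_Lp_nonneg F
  have hG0 := norm_Lp_nonneg G
  have hsum := norm_add_rpow_add_norm_sub_rpow_le hp0 F G
  rw [← hMdef] at hsum
  have hexp : (2 - p) / p * (p / 2) = (2 - p) / 2 := by field_simp
  have hS0 (x : Ω) : 0 ≤ S x := by positivity
  have hD0 (x : Ω) : 0 ≤ S x / 2 - |F x| ^ p := by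
    have hle : k * G x ^ 2 ≤ S x ^ ((2 - p) / p) * (S x / 2 - |F x| ^ p) :=
      mul_sq_le_rpow_mul_sub hp hp2 (F x) (G x)
    by_contra! hneg
    rcases (hS0 x).eq_or_lt with h | h
    · have h1 : |F x + G x| ^ p = 0 :=
        le_antisymm (by linarith [(by positivity : 0 ≤ |F x - G x| ^ p)]) (by positivity)
      have h2 : |F x - G x| ^ p = 0 := by linarith
      rw [Real.rpow_eq_zero (abs_nonneg _) hp0.ne', abs_eq_zero] at h1 h2
      have h3 : F x = 0 := by linarith
      rw [← h, h3, abs_zero, Real.zero_rpow hp0.ne'] at hneg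
      norm_num at hneg
    · have h1 : 0 < S x ^ ((2 - p) / p) := by positivity
      nlinarith [sq_nonneg (G x)]
  have hpoint (x : Ω) : k ^ (p / 2) * |G x| ^ p ≤
      S x ^ ((2 - p) / 2) * (S x / 2 - |F x| ^ p) ^ (p / 2) := by
    have h := Real.rpow_le_rpow (by positivity) (mul_sq_le_rpow_mul_sub hp hp2 (F x) (G x))
      (by positivity : 0 ≤ p / 2)
    rw [Real.mul_rpow hk.le (sq_nonneg _), Real.mul_rpow (Real.rpow_nonneg (hS0 x) _) (hD0 x),
      ← Real.rpow_mul (hS0 x), hexp, ← sq_abs, ← Real.rpow_natCast,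
      ← Real.rpow_mul (abs_nonneg _)] at h
    rwa [show ((2 : ℕ) : ℝ) * (p / 2) = p by push_cast; ring] at h
  have hD : Integrable (fun x => S x / 2 - |F x| ^ p) μ := (hS.div_const 2).sub hF
  have hholder := integral_le_rpow_integral_mul_rpow_integral hS hD
    (hG.const_mul (k ^ (p / 2))) (.of_forall hS0) (.of_forall hD0)
    (.of_forall fun x => by positivity) (by linarith : 0 ≤ (2 - p) / 2)
    (by linarith : 0 ≤ p / 2) (by ring) (.of_forall hpoint)
  have hDint : 0 ≤ ∫ x, (S x / 2 - |F x| ^ p) ∂μ := integral_nonneg hD0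
  have hSint : 0 ≤ ∫ x, S x ∂μ := integral_nonneg hS0
  have hDle : ∫ x, (S x / 2 - |F x| ^ p) ∂μ ≤ M ^ p - ‖F‖ ^ p := by
    rw [integral_sub (hS.div_const 2) hF, integral_div, hSeq, ← norm_Lp_rpow_eq_integral hp0]
    linarith
  have hFM : ‖F‖ ^ p ≤ M ^ p := by linarith
  have hFM' : ‖F‖ ≤ M := (Real.rpow_le_rpow_iff (norm_Lp_nonneg _) hM hp0).1 hFM
  rw [integral_const_mul, ← norm_Lp_rpow_eq_integral hp0] at hholder
  have hroot : k * ‖G‖ ^ (2 : ℝ) ≤ (2 * M ^ p) ^ ((2 - p) / p) * (M ^ p - ‖F‖ ^ p) := by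
    have hd : 0 ≤ M ^ p - ‖F‖ ^ p := by linarith
    rw [← Real.rpow_le_rpow_iff (by positivity) (by positivity) (by positivity : 0 < p / 2),
      Real.mul_rpow hk.le (by positivity), Real.mul_rpow (by positivity) hd,
      ← Real.rpow_mul (by positivity), ← Real.rpow_mul (by positivity), hexp,
      mul_div_cancel₀ p two_ne_zero]
    refine hholder.trans ?_
    have h0 : 0 ≤ (2 - p) / 2 := by linarith
    gcongr
    exact hSeq.trans_le hsum
  have hpow : (2 * M ^ p) ^ ((2 - p) / p) = 2 ^ ((2 - p) / p) * M ^ (2 - p) := by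
    rw [Real.mul_rpow two_pos.le (by positivity), ← Real.rpow_mul hM, mul_div_cancel₀ _ hp0.ne']
  have hsplit {x : ℝ} (hx : 0 ≤ x) : x ^ (2 : ℝ) = x ^ (2 - p) * x ^ p := by
    rw [← Real.rpow_add_of_nonneg hx (by linarith) hp0.le, sub_add_cancel]
  have hF2 : ‖F‖ ^ (2 : ℝ) ≤ M ^ (2 - p) * ‖F‖ ^ p := by
    rw [hsplit (norm_Lp_nonneg F)]
    exact mul_le_mul_of_nonneg_right
      (Real.rpow_le_rpow (norm_Lp_nonneg _) hFM' (by linarith)) (by positivity)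
  have hfinal : k / 2 ^ ((2 - p) / p) * ‖G‖ ^ (2 : ℝ) ≤ M ^ (2 - p) * (M ^ p - ‖F‖ ^ p) := by
    rw [div_mul_eq_mul_div, div_le_iff₀ (by positivity)]
    rw [hpow] at hroot
    linarith
  rw [hsplit hM]
  linarith

end Lp

/-- For `1 < p < ∞` there exists `m > 0`, depending only on `p`, such that for
every measure space `(Ω, μ)` and all `F, G ∈ L^p(μ)`:
`max(‖F+G‖_p, ‖F−G‖_p)^{max(p,2)} ≥ ‖F‖_p^{max(p,2)} + m ‖G‖_p^{max(p,2)}`. -/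
theorem stmt4.{u} (p : ℝ) (hp : 1 < p) :
    ∃ m : ℝ, 0 < m ∧
      ∀ (Ω : Type u) [MeasurableSpace Ω] (μ : Measure Ω)
        (F G : Lp ℝ (ENNReal.ofReal p) μ),
        ‖F‖ ^ max p 2 + m * ‖G‖ ^ max p 2 ≤ (max ‖F + G‖ ‖F - G‖) ^ max p 2 := by
  rcases le_or_gt 2 p with h2 | h2
  · refine ⟨1, one_pos, fun Ω _ μ F G => ?_⟩
    rw [max_eq_left h2, one_mul]
    exact norm_rpow_add_norm_rpow_le h2 F G
  · refine ⟨p * (p - 1) / 2 / 2 ^ ((2 - p) / p), ?_, fun Ω _ μ F G => ?_⟩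
    · have : 0 < p - 1 := by linarith
      positivity
    · rw [max_eq_right h2.le]
      exact norm_sq_add_mul_norm_sq_le hp h2 F G
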